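/- arXiv:2602.07473 — 5 statements merged into one kernel-verified Lean document; each statement's English description precedes it below -/
import Mathlib

section
/- Let P be a POMDP with target set T of states and initial belief b. Then there exists a POMDP P' (constructible in time linear in the size of P) containing two new states ⊤ and ⊥, and an initial belief b' for P', such that: (i) both ⊤ and ⊥ are absorbing and observable in P'; (ii) ⊥ is the only state of P' with reachability value 0; and (iii) the reachability value is preserved, i.e., Val^P_T(b) = Val^{P'}_{{⊤}}(b'). -/
open scoped ENNReal BigOperators Classical
open Filter Topology

/-- A partially observable Markov decision process with finite state space `Q`,
finite action space `A` and finite observation space `O`.  `tr q a o q'` is the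
probability `T(o, q' | q, a)` of receiving observation `o` and moving to state `q'`
when taking action `a` in state `q`. -/
structure POMDP (Q A O : Type) [Fintype Q] [Fintype A] [Fintype O] where
  tr : Q → A → O → Q → ℝ≥0∞
  tr_sum_one : ∀ q a, (∑ o : O, ∑ q' : Q, tr q a o q') = 1

/-- An (observation-based) strategy: to each observable history it assigns a
probability distribution on actions. -/
structure Strategy (A O : Type) [Fintype A] where
  act : List (A × O) → A → ℝ≥0∞
  act_sum_one : ∀ h, (∑ a : A, act h a) = 1

/-- Support of a (sub-)belief. -/
noncomputable def beliefSupp {Q : Type} [Fintype Q] (b : Q → ℝ≥0∞) : Finset Q :=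
  Finset.univ.filter fun q => b q ≠ 0

/-- Dirac belief at a state. -/
noncomputable def dirac {Q : Type} (q : Q) : Q → ℝ≥0∞ := fun q' => if q' = q then 1 else 0

/-- Restriction of a (sub-)belief to a set of states. -/
noncomputable def restrictBel {Q : Type} (b : Q → ℝ≥0∞) (C : Finset Q) : Q → ℝ≥0∞ :=
  fun q => if q ∈ C then b q else 0

/-- The sequence of states visited by a history. -/
def statesOf {Q A O : Type} (q0 : Q) (l : List (A × O × Q)) : List Q :=
  q0 :: l.map fun x => x.2.2

/-- The observable projection of a history. -/
def obsOf {Q A O : Type} (l : List (A × O × Q)) : List (A × O) :=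
  l.map fun x => (x.1, x.2.1)

/-- A history hits the target set `Tset` for the first time at its last state. -/
def FirstHit {Q A O : Type} (Tset : Set Q) (q0 : Q) (l : List (A × O × Q)) : Prop :=
  (∃ q ∈ Tset, (statesOf q0 l).getLast? = some q) ∧
    ∀ q' ∈ (statesOf q0 l).dropLast, q' ∉ Tset

/-- The prefix of length `n` of an observable run. -/
def runPrefix {A O : Type} (ρ : ℕ → A × O) (n : ℕ) : List (A × O) :=
  List.ofFn fun i : Fin n => ρ i

namespace POMDP

variable {Q A O : Type} [Fintype Q] [Fintype A] [Fintype O]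

/-- Marginal probability `T(o | q, a)` of receiving observation `o`. -/
noncomputable def trO (P : POMDP Q A O) (q : Q) (a : A) (o : O) : ℝ≥0∞ := ∑ q' : Q, P.tr q a o q'

/-- A POMDP is posterior-deterministic if for every `(q, a, o)` there is at most one
successor state with positive probability. -/
def PostDet (P : POMDP Q A O) : Prop :=
  ∀ q a o q₁ q₂, P.tr q a o q₁ ≠ 0 → P.tr q a o q₂ ≠ 0 → q₁ = q₂

/-- The set of possible successors of `q` under action `a` and observation `o`
(in a posterior-deterministic POMDP, at most a singleton: `δ(q,a,o)`). -/
noncomputable def succs (P : POMDP Q A O) (q : Q) (a : A) (o : O) : Finset Q :=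
  Finset.univ.filter fun q' => P.tr q a o q' ≠ 0

/-- `δ(S, a, o)` on sets of states. -/
noncomputable def stepSet (P : POMDP Q A O) (S : Finset Q) (a : A) (o : O) : Finset Q :=
  S.biUnion fun q => P.succs q a o

/-- `δ*(S, h)` on sets of states along an observable history. -/
noncomputable def stepSetStar (P : POMDP Q A O) : Finset Q → List (A × O) → Finset Q
  | S, [] => S
  | S, (a, o) :: h => P.stepSetStar (P.stepSet S a o) h

/-- `T(o | b, a)`, the probability of observing `o` from (sub-)belief `b` after action `a`. -/
noncomputable def trOBel (P : POMDP Q A O) (b : Q → ℝ≥0∞) (a : A) (o : O) : ℝ≥0∞ :=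
  ∑ q : Q, b q * P.trO q a o

/-- Belief update `b_{a,o}`. -/
noncomputable def belStep (P : POMDP Q A O) (b : Q → ℝ≥0∞) (a : A) (o : O) : Q → ℝ≥0∞ :=
  fun q => (∑ q' : Q, b q' * P.tr q' a o q) / P.trOBel b a o

/-- Iterated belief update `δ*(b, h)` along an observable history. -/
noncomputable def belStepStar (P : POMDP Q A O) : (Q → ℝ≥0∞) → List (A × O) → Q → ℝ≥0∞
  | b, [] => b
  | b, (a, o) :: h => P.belStepStar (P.belStep b a o) h

/-- Probability of the continuation of a history under a strategy:
`runProbAux σ hist q l` is the probability, starting from state `q` after the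
observable history `hist`, that the next steps are exactly `l`. -/
noncomputable def runProbAux (P : POMDP Q A O) (σ : Strategy A O) :
    List (A × O) → Q → List (A × O × Q) → ℝ≥0∞
  | _, _, [] => 1
  | hist, q, (a, o, q') :: rest =>
      σ.act hist a * P.tr q a o q' * P.runProbAux σ (hist ++ [(a, o)]) q' rest

/-- Probability `P_b^σ(Cyl(q0, l))` of the cylinder of a history. -/
noncomputable def histProb (P : POMDP Q A O) (b : Q → ℝ≥0∞) (σ : Strategy A O)
    (q0 : Q) (l : List (A × O × Q)) : ℝ≥0∞ :=
  b q0 * P.runProbAux σ [] q0 l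

/-- Probability `P_b^σ(Reach(Tset))` of eventually visiting the target set:
the sum of cylinder probabilities over all histories hitting `Tset` for the first
time at their last state. -/
noncomputable def reachProb (P : POMDP Q A O) (Tset : Set Q) (b : Q → ℝ≥0∞)
    (σ : Strategy A O) : ℝ≥0∞ :=
  ∑' p : Q × List (A × O × Q), if FirstHit Tset p.1 p.2 then P.histProb b σ p.1 p.2 else 0

/-- The reachability value `Val(b) = sup_σ P_b^σ(Reach(Tset))`. -/
noncomputable def val (P : POMDP Q A O) (Tset : Set Q) (b : Q → ℝ≥0∞) : ℝ≥0∞ :=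
  ⨆ σ : Strategy A O, P.reachProb Tset b σ

/-- `Val(b, a) = Σ_o T(o | b, a) · Val(b_{a,o})`. -/
noncomputable def valAct (P : POMDP Q A O) (Tset : Set Q) (b : Q → ℝ≥0∞) (a : A) : ℝ≥0∞ :=
  ∑ o : O, P.trOBel b a o * P.val Tset (P.belStep b a o)

/-- A state is absorbing if once reached the system stays there forever. -/
def Absorbing (P : POMDP Q A O) (q : Q) : Prop :=
  ∀ a o q', P.tr q a o q' ≠ 0 → q' = q

/-- A state is observable if there is an observation received exactly when
entering this state. -/
def Observable (P : POMDP Q A O) (q : Q) : Prop :=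
  ∃ o : O, ∀ p a o' q', P.tr p a o' q' ≠ 0 → (q' = q ↔ o' = o)

/-- An observable history is inside a partial function `(dom, act)` from a support
`S`: every action taken is prescribed by `act` at the current support, which stays
in `dom`. -/
def InsideFrom (P : POMDP Q A O) (dom : Set (Finset Q)) (act : Finset Q → Finset A) :
    Finset Q → List (A × O) → Prop
  | _, [] => True
  | S, (a, o) :: h => S ∈ dom ∧ a ∈ act S ∧ InsideFrom P dom act (P.stepSet S a o) h

/-- A support end component (SEC): a partial function from nonempty belief supports
to nonempty sets of actions, closed under prescribed transitions and strongly
connected via prescribed histories. -/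
structure SEC (P : POMDP Q A O) where
  dom : Set (Finset Q)
  act : Finset Q → Finset A
  dom_nonempty : ∀ S ∈ dom, S.Nonempty
  act_nonempty : ∀ S ∈ dom, (act S).Nonempty
  closed : ∀ S ∈ dom, ∀ a ∈ act S, ∀ o : O, (P.stepSet S a o).Nonempty → P.stepSet S a o ∈ dom
  connected : ∀ S ∈ dom, ∀ S' ∈ dom,
      ∃ h : List (A × O), InsideFrom P dom act S h ∧ P.stepSetStar S h = S'

/-- `f` is contained in `f'`. -/
def SEC.Contained {P : POMDP Q A O} (f f' : SEC P) : Prop :=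
  f.dom ⊆ f'.dom ∧ ∀ S ∈ f.dom, f.act S ⊆ f'.act S

/-- A maximal SEC: any SEC containing it coincides with it. -/
def SEC.Maximal {P : POMDP Q A O} (f : SEC P) : Prop :=
  ∀ f' : SEC P, f.Contained f' → f'.dom = f.dom ∧ ∀ S ∈ f.dom, f'.act S = f.act S

/-- `(f, S)`-indistinguishability of two states `q, q' ∈ S`: along every history
inside `f` from `S`, the observation distributions from the (unique) successors of
`q` and `q'` agree for all prescribed actions. -/
def Indist (P : POMDP Q A O) (f : SEC P) (S : Finset Q) (q q' : Q) : Prop :=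
  ∀ h : List (A × O), InsideFrom P f.dom f.act S h →
    ∀ a ∈ f.act (P.stepSetStar S h), ∀ o : O,
      ∀ x ∈ P.stepSetStar {q} h, ∀ y ∈ P.stepSetStar {q'} h,
        P.trO x a o = P.trO y a o

/-- A distinguishing SEC. -/
def SEC.Distinguishing {P : POMDP Q A O} (f : SEC P) : Prop :=
  ∃ S ∈ f.dom, ∃ q ∈ S, ∃ q' ∈ S, ¬ Indist P f S q q'

/-- A non-distinguishing SEC. -/
def SEC.NonDistinguishing {P : POMDP Q A O} (f : SEC P) : Prop :=
  ∀ S ∈ f.dom, ∀ q ∈ S, ∀ q' ∈ S, Indist P f S q q'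

/-- The `(f,S)`-indistinguishability class of `q` inside `S`. -/
noncomputable def classOf (P : POMDP Q A O) (f : SEC P) (S : Finset Q) (q : Q) : Finset Q :=
  S.filter fun q' => Indist P f S q q'

/-- `Reach_f(b)`: the set of beliefs reachable from `b` by histories inside `f`. -/
def reachBel (P : POMDP Q A O) (f : SEC P) (b : Q → ℝ≥0∞) : Set (Q → ℝ≥0∞) :=
  {b' | ∃ h : List (A × O), InsideFrom P f.dom f.act (beliefSupp b) h ∧ P.belStepStar b h = b'}

/-- An observable run stays inside `f` from the support `S0`. -/
def RunInside (P : POMDP Q A O) (f : SEC P) (S0 : Finset Q) (ρ : ℕ → A × O) : Prop :=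
  ∀ n : ℕ, InsideFrom P f.dom f.act S0 (runPrefix ρ n)

/-- The a-posteriori probability `X_q^n(ρ) = δ*(b, ρ|_n)(δ*(q, ρ|_n))` of having
started in `q`, given the first `n` action-observation pairs of `ρ`. -/
noncomputable def Xpost (P : POMDP Q A O) (b : Q → ℝ≥0∞) (q : Q) (ρ : ℕ → A × O)
    (n : ℕ) : ℝ≥0∞ :=
  ∑ x ∈ P.stepSetStar {q} (runPrefix ρ n), P.belStepStar b (runPrefix ρ n) x

/-- A history `h = h' ++ [(a,o)]` distinguishes `q` and `q'`:
`T(o | δ*(q,h'), a) ≠ T(o | δ*(q',h'), a)`. -/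
def HistDistinguishes (P : POMDP Q A O) (q q' : Q) (h : List (A × O)) : Prop :=
  ∃ (h' : List (A × O)) (ao : A × O), h = h' ++ [ao] ∧
    (∑ x ∈ P.stepSetStar {q} h', P.trO x ao.1 ao.2) ≠
      (∑ x ∈ P.stepSetStar {q'} h', P.trO x ao.1 ao.2)

/-- The number of (nonempty) prefixes of `h` distinguishing `q` and `q'`. -/
noncomputable def distCount (P : POMDP Q A O) (q q' : Q) (h : List (A × O)) : ℕ :=
  ((Finset.range (h.length + 1)).filter fun i => P.HistDistinguishes q q' (h.take i)).card

/-- Probability `P_b^σ(Cyl(h))` of the cylinder of an observable history. -/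
noncomputable def obsCylProb (P : POMDP Q A O) (b : Q → ℝ≥0∞) (σ : Strategy A O)
    (h : List (A × O)) : ℝ≥0∞ :=
  ∑' p : Q × List (A × O × Q), if obsOf p.2 = h then P.histProb b σ p.1 p.2 else 0

/-- Probability `P_b^σ(initial state is q ∧ Cyl(h))`. -/
noncomputable def jointProb (P : POMDP Q A O) (b : Q → ℝ≥0∞) (σ : Strategy A O)
    (q : Q) (h : List (A × O)) : ℝ≥0∞ :=
  ∑' l : List (A × O × Q), if obsOf l = h then P.histProb b σ q l else 0

/-- `X_q^n` evaluated on the `F_n`-atom of the observable history `h`: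
the conditional probability of having started in `q` given `Cyl(h)`. -/
noncomputable def condX (P : POMDP Q A O) (b : Q → ℝ≥0∞) (σ : Strategy A O)
    (q : Q) (h : List (A × O)) : ℝ≥0∞ :=
  P.jointProb b σ q h / P.obsCylProb b σ h

/-- Probability `P_b^σ(∃ prefix whose observable history satisfies E)`: the sum of
cylinder probabilities over histories satisfying `E` for the first time. -/
noncomputable def eventProb (P : POMDP Q A O) (b : Q → ℝ≥0∞) (σ : Strategy A O)
    (E : List (A × O) → Prop) : ℝ≥0∞ :=
  ∑' p : Q × List (A × O × Q),
    if E (obsOf p.2) ∧ ∀ l' : List (A × O × Q), l' <+: p.2 → l' ≠ p.2 → ¬ E (obsOf l')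
    then P.histProb b σ p.1 p.2 else 0

/-- The set of actions used by the uniform strategy of an SEC `f` after an
observable history (the prescribed actions if the current support has some,
all actions otherwise). -/
noncomputable def unifSupport (P : POMDP Q A O) (f : SEC P) (S0 : Finset Q)
    (h : List (A × O)) : Finset A :=
  if (f.act (P.stepSetStar S0 h)).Nonempty then f.act (P.stepSetStar S0 h) else Finset.univ

theorem unifSupport_nonempty [Nonempty A] (P : POMDP Q A O) (f : SEC P) (S0 : Finset Q)
    (h : List (A × O)) : (P.unifSupport f S0 h).Nonempty := by
  unfold unifSupport
  split
  · assumption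
  · exact Finset.univ_nonempty

/-- The uniform strategy `unif_f`: it tracks the current belief support and picks a
prescribed action uniformly at random. -/
noncomputable def unifStrat [Nonempty A] (P : POMDP Q A O) (f : SEC P) (S0 : Finset Q) :
    Strategy A O where
  act h a := if a ∈ P.unifSupport f S0 h then ((P.unifSupport f S0 h).card : ℝ≥0∞)⁻¹ else 0
  act_sum_one := by
    intro h
    have hne := P.unifSupport_nonempty f S0 h
    rw [Finset.sum_ite_mem, Finset.univ_inter, Finset.sum_const, nsmul_eq_mul,
      ENNReal.mul_inv_cancel]
    · exact Nat.cast_ne_zero.mpr (Finset.card_ne_zero.mpr hne)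
    · exact ENNReal.natCast_ne_top _

end POMDP

namespace POMDP

section Aux

set_option linter.unusedSectionVars false

theorem tsum_list_cons {α : Type} [Fintype α] (f : List α → ℝ≥0∞) :
    ∑' l, f l = f [] + ∑ x : α, ∑' l, f (x :: l) := by
  let e : Option (α × List α) ≃ List α :=
    { toFun := fun o => match o with
        | none => []
        | some (x, l) => x :: l
      invFun := fun l => match l with
        | [] => none
        | x :: l => some (x, l)
      left_inv := by rintro (_ | ⟨x, l⟩) <;> rfl
      right_inv := by rintro (_ | ⟨x, l⟩) <;> rfl }
  rw [← e.tsum_eq f, ENNReal.tsum_eq_add_tsum_ite none]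
  congr 1
  rw [← tsum_fintype (L := SummationFilter.unconditional _),
    ← ENNReal.tsum_prod (f := fun x l => f (x :: l))]
  rw [← (Option.some_injective (α × List α)).tsum_eq]
  · exact tsum_congr fun c => by simp [e]
  · rintro (_ | c) hc
    · simp at hc
    · simp

variable {Q A O : Type} [Fintype Q] [Fintype A] [Fintype O]

theorem firstHit_nil (T : Set Q) (q : Q) :
    FirstHit T q ([] : List (A × O × Q)) ↔ q ∈ T := by
  simp [FirstHit, statesOf]

theorem firstHit_cons (T : Set Q) (q : Q) (x : A × O × Q) (l : List (A × O × Q)) :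
    FirstHit T q (x :: l) ↔ q ∉ T ∧ FirstHit T x.2.2 l := by
  simp only [FirstHit, statesOf, List.map_cons, List.getLast?_cons_cons, List.dropLast_cons_cons,
    List.mem_cons, forall_eq_or_imp]
  tauto

/-- weight of a history -/
noncomputable def wt (P : POMDP Q A O) (T : Set Q) (σ : Strategy A O)
    (h : List (A × O)) (q : Q) (l : List (A × O × Q)) : ℝ≥0∞ :=
  if FirstHit T q l then P.runProbAux σ h q l else 0

/-- reach probability from a state after a history -/
noncomputable def rp (P : POMDP Q A O) (T : Set Q) (σ : Strategy A O)
    (h : List (A × O)) (q : Q) : ℝ≥0∞ := ∑' l, P.wt T σ h q l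

/-- one-step operator -/
noncomputable def stepOp (P : POMDP Q A O) (σ : Strategy A O)
    (X : List (A × O) → Q → ℝ≥0∞) (h : List (A × O)) (q : Q) : ℝ≥0∞ :=
  ∑ a : A, σ.act h a * ∑ o : O, ∑ q' : Q, P.tr q a o q' * X (h ++ [(a, o)]) q'

variable (P : POMDP Q A O) (T : Set Q) (σ : Strategy A O)

theorem wt_nil (h : List (A × O)) (q : Q) : P.wt T σ h q [] = if q ∈ T then 1 else 0 := by
  simp [wt, firstHit_nil, runProbAux]

theorem wt_cons (h : List (A × O)) (q : Q) (a : A) (o : O) (q' : Q) (l : List (A × O × Q)) :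
    P.wt T σ h q ((a, o, q') :: l) =
      if q ∈ T then 0 else σ.act h a * P.tr q a o q' * P.wt T σ (h ++ [(a, o)]) q' l := by
  by_cases hq : q ∈ T <;> simp [wt, firstHit_cons, runProbAux, hq]

theorem rp_mem {h : List (A × O)} {q : Q} (hq : q ∈ T) : P.rp T σ h q = 1 := by
  rw [rp, tsum_list_cons, wt_nil]
  simp [hq, wt_cons]

theorem rp_not_mem {h : List (A × O)} {q : Q} (hq : q ∉ T) :
    P.rp T σ h q = P.stepOp σ (P.rp T σ) h q := by
  rw [rp, tsum_list_cons, wt_nil]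
  simp only [hq, if_false, zero_add, wt_cons, Fintype.sum_prod_type, stepOp, rp,
    ENNReal.tsum_mul_left, Finset.mul_sum, mul_assoc]

theorem rp_le (X : List (A × O) → Q → ℝ≥0∞) (h1 : ∀ h, ∀ q ∈ T, 1 ≤ X h q)
    (h2 : ∀ h, ∀ q ∉ T, P.stepOp σ X h q ≤ X h q) (h : List (A × O)) (q : Q) :
    P.rp T σ h q ≤ X h q := by
  have key : ∀ n h q, ∑' l, (if l.length < n then P.wt T σ h q l else 0) ≤ X h q := by
    intro n
    induction n with
    | zero => intro h q; simp
    | succ n ih =>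
      intro h q
      rw [tsum_list_cons, wt_nil]
      by_cases hq : q ∈ T
      · have h0 : ∀ (x : A × O × Q) l, P.wt T σ h q (x :: l) = 0 := by
          rintro ⟨a, o, q'⟩ l
          simp [wt_cons, hq]
        simpa [hq, h0] using h1 h q hq
      · refine le_trans ?_ (h2 h q hq)
        simp only [hq, if_false, wt_cons, Fintype.sum_prod_type, List.length_cons, stepOp,
          Finset.mul_sum, ite_self, zero_add, add_lt_add_iff_right]
        refine Finset.sum_le_sum fun a _ => Finset.sum_le_sum fun o _ =>
          Finset.sum_le_sum fun q' _ => ?_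
        rw [← mul_assoc]
        simp only [← mul_ite_zero, ENNReal.tsum_mul_left]
        gcongr
        exact ih _ _
  refine ENNReal.summable.tsum_le_of_sum_le fun s => ?_
  refine le_trans ?_ (key (s.sup List.length + 1) h q)
  refine le_trans (Finset.sum_le_sum fun l hl => ?_) (ENNReal.sum_le_tsum s)
  rw [if_pos (Nat.lt_succ_of_le (Finset.le_sup (f := List.length) hl))]

theorem reachProb_eq (b : Q → ℝ≥0∞) : P.reachProb T b σ = ∑ q, b q * P.rp T σ [] q := by
  rw [reachProb, ENNReal.tsum_prod (f := fun q l => if FirstHit T q l then P.histProb b σ q l else 0),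
    tsum_fintype]
  refine Finset.sum_congr rfl fun q _ => ?_
  rw [rp, ← ENNReal.tsum_mul_left]
  refine tsum_congr fun l => ?_
  simp [wt, histProb]

theorem reachProb_dirac (q : Q) : P.reachProb T (dirac q) σ = P.rp T σ [] q := by
  rw [reachProb_eq]; simp [dirac]

/-- target is graph-reachable -/
inductive Pos (P : POMDP Q A O) (T : Set Q) : Q → Prop
  | base {q : Q} : q ∈ T → Pos P T q
  | step {q : Q} {a : A} {o : O} {q' : Q} : P.tr q a o q' ≠ 0 → Pos P T q' → Pos P T q

/-- translation of states -/
noncomputable def gmap (q : Q) : Q ⊕ Bool :=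
  if q ∈ T then Sum.inr true else if Pos P T q then Sum.inl q else Sum.inr false

/-- translation of observations -/
noncomputable def fmap (o : O) (q : Q) : O ⊕ Bool :=
  if q ∈ T then Sum.inr true else if Pos P T q then Sum.inl o else Sum.inr false

/-- new transition function -/
noncomputable def newTr : Q ⊕ Bool → A → O ⊕ Bool → Q ⊕ Bool → ℝ≥0∞
  | Sum.inr c, _, o', s' => if o' = Sum.inr c ∧ s' = Sum.inr c then 1 else 0
  | Sum.inl q, a, o', s' =>
    if q ∉ T ∧ Pos P T q then
      ∑ o, ∑ q', if o' = fmap P T o q' ∧ s' = gmap P T q' then P.tr q a o q' else 0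
    else if o' = Sum.inr true ∧ s' = Sum.inr true then 1 else 0

theorem sum_pt {X Y : Type} [Fintype X] [Fintype Y] [DecidableEq X] [DecidableEq Y] (x0 : X) (y0 : Y) (w : ℝ≥0∞)
    (G : X → Y → ℝ≥0∞) :
    ∑ x, ∑ y, (if x = x0 ∧ y = y0 then w else 0) * G x y = w * G x0 y0 := by
  rw [Finset.sum_eq_single x0, Finset.sum_eq_single y0]
  · simp
  · intro y _ hy; simp [hy]
  · simp
  · intro x _ hx; simp [hx]
  · simp

theorem newTr_sum_inr (c : Bool) (a : A) (G : O ⊕ Bool → Q ⊕ Bool → ℝ≥0∞) :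
    ∑ o', ∑ s', P.newTr T (Sum.inr c) a o' s' * G o' s' = G (Sum.inr c) (Sum.inr c) := by
  simp only [newTr, sum_pt, one_mul]

theorem newTr_sum_bad (q : Q) (hq : ¬ (q ∉ T ∧ Pos P T q)) (a : A)
    (G : O ⊕ Bool → Q ⊕ Bool → ℝ≥0∞) :
    ∑ o', ∑ s', P.newTr T (Sum.inl q) a o' s' * G o' s' = G (Sum.inr true) (Sum.inr true) := by
  simp only [newTr, if_neg hq, sum_pt, one_mul]

theorem newTr_sum_good (q : Q) (hq : q ∉ T ∧ Pos P T q) (a : A)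
    (G : O ⊕ Bool → Q ⊕ Bool → ℝ≥0∞) :
    ∑ o', ∑ s', P.newTr T (Sum.inl q) a o' s' * G o' s' =
      ∑ o, ∑ q', P.tr q a o q' * G (fmap P T o q') (gmap P T q') := by
  simp only [newTr, if_pos hq, Finset.sum_mul]
  calc _ = ∑ o', ∑ o, ∑ q', ∑ s', (if o' = fmap P T o q' ∧ s' = gmap P T q' then
          P.tr q a o q' else 0) * G o' s' := by
        refine Finset.sum_congr rfl fun o' _ => ?_
        rw [Finset.sum_comm]
        refine Finset.sum_congr rfl fun o _ => ?_
        rw [Finset.sum_comm]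
    _ = _ := by
        rw [Finset.sum_comm]
        refine Finset.sum_congr rfl fun o _ => ?_
        rw [Finset.sum_comm]
        refine Finset.sum_congr rfl fun q' _ => ?_
        rw [sum_pt]

/-- the new POMDP -/
noncomputable def newP : POMDP (Q ⊕ Bool) A (O ⊕ Bool) where
  tr := P.newTr T
  tr_sum_one := by
    intro s a
    rcases s with q | c
    · by_cases hq : q ∉ T ∧ Pos P T q
      · simpa [P.tr_sum_one] using P.newTr_sum_good T q hq a (fun _ _ => 1)
      · simpa using P.newTr_sum_bad T q hq a (fun _ _ => 1)
    · simpa using P.newTr_sum_inr T c a (fun _ _ => 1)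

/-- the new belief -/
noncomputable def newB (b : Q → ℝ≥0∞) (s : Q ⊕ Bool) : ℝ≥0∞ :=
  ∑ q, if s = gmap P T q then b q else 0

theorem newB_sum (b : Q → ℝ≥0∞) (G : Q ⊕ Bool → ℝ≥0∞) :
    ∑ s, P.newB T b s * G s = ∑ q, b q * G (gmap P T q) := by
  simp only [newB, Finset.sum_mul]
  rw [Finset.sum_comm]
  refine Finset.sum_congr rfl fun q _ => ?_
  simp

theorem newP_absorbing (c : Bool) : (P.newP T).Absorbing (Sum.inr c) := by
  intro a o q' h
  simp only [newP, newTr, ne_eq, ite_eq_right_iff, Classical.not_imp] at h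
  exact h.1.2

theorem newP_observable (c : Bool) : (P.newP T).Observable (Sum.inr c) := by
  refine ⟨Sum.inr c, ?_⟩
  intro s a o' s' h
  rcases s with q | d
  · by_cases hq : q ∉ T ∧ Pos P T q
    · simp only [newP, newTr, if_pos hq] at h
      obtain ⟨o, _, h⟩ := Finset.exists_ne_zero_of_sum_ne_zero h
      obtain ⟨q', _, h⟩ := Finset.exists_ne_zero_of_sum_ne_zero h
      simp only [ne_eq, ite_eq_right_iff, Classical.not_imp] at h
      obtain ⟨⟨rfl, rfl⟩, _⟩ := h
      unfold gmap fmap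
      split_ifs <;> simp
    · simp only [newP, newTr, if_neg hq, ne_eq, ite_eq_right_iff, Classical.not_imp] at h
      obtain ⟨⟨rfl, rfl⟩, _⟩ := h
      simp
  · simp only [newP, newTr, ne_eq, ite_eq_right_iff, Classical.not_imp] at h
    obtain ⟨⟨rfl, rfl⟩, _⟩ := h
    simp

/-- embedding of histories -/
def emb (h : List (A × O)) : List (A × (O ⊕ Bool)) := h.map fun x => (x.1, Sum.inl x.2)

theorem emb_append (h : List (A × O)) (a : A) (o : O) :
    emb (h ++ [(a, o)]) = emb h ++ [(a, Sum.inl o)] := by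
  simp [emb]

theorem emb_inj : Function.Injective (emb : List (A × O) → _) := by
  refine List.map_injective_iff.mpr ?_
  rintro ⟨a, o⟩ ⟨a', o'⟩ h
  simpa using h

variable (σ' : Strategy A (O ⊕ Bool))

theorem rp_top (h : List (A × (O ⊕ Bool))) :
    (P.newP T).rp {Sum.inr true} σ' h (Sum.inr true) = 1 := rp_mem _ _ _ rfl

theorem rp_bad (h : List (A × (O ⊕ Bool))) (q : Q) (hq : ¬ (q ∉ T ∧ Pos P T q)) :
    (P.newP T).rp {Sum.inr true} σ' h (Sum.inl q) = 1 := by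
  rw [rp_not_mem _ _ _ (by simp), stepOp]
  have := fun a => P.newTr_sum_bad T q hq a
    (fun o' s' => (P.newP T).rp {Sum.inr true} σ' (h ++ [(a, o')]) s')
  simp only [newP] at this ⊢
  simp only [this]
  simp [rp_mem, σ'.act_sum_one]

theorem newP_le (hσ : ∀ h, σ'.act (emb h) = σ.act h) (h : List (A × (O ⊕ Bool)))
    (s : Q ⊕ Bool) :
    (P.newP T).rp {Sum.inr true} σ' h s ≤
      match s with
      | Sum.inr c => if c = true then 1 else 0
      | Sum.inl q => if q ∉ T ∧ Pos P T q then ⨅ h₀, ⨅ (_ : h = emb h₀), P.rp T σ h₀ q else 1 := by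
  revert h s
  refine rp_le _ _ _ (fun h s => match s with
      | Sum.inr c => if c = true then 1 else 0
      | Sum.inl q => if q ∉ T ∧ Pos P T q then ⨅ h₀, ⨅ (_ : h = emb h₀), P.rp T σ h₀ q else 1)
      ?_ ?_
  · rintro h s rfl
    simp
  · rintro h (q | c) hs
    · unfold stepOp
      by_cases hq : q ∉ T ∧ Pos P T q
      · simp only [newP, P.newTr_sum_good T q hq]
        rw [if_pos hq]
        refine le_iInf₂ ?_
        rintro h₀ rfl
        rw [rp_not_mem _ _ _ hq.1, stepOp, hσ]
        refine Finset.sum_le_sum fun a _ => ?_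
        gcongr with o _ q' _
        by_cases h1 : q' ∈ T
        · simp [gmap, fmap, h1, rp_mem]
        · by_cases h2 : Pos P T q'
          · simp only [gmap, fmap, h1, h2, if_true, if_false, not_false_eq_true, and_self]
            exact iInf₂_le (f := fun h₀ (_ : _ = emb h₀) => P.rp T σ h₀ q') (h₀ ++ [(a, o)])
              (emb_append h₀ a o).symm
          · simp [gmap, fmap, h1, h2]
      · simp only [newP, P.newTr_sum_bad T q hq]
        simp [hq, σ'.act_sum_one]
    · unfold stepOp
      simp only [newP, newTr_sum_inr]
      rw [← Finset.sum_mul, σ'.act_sum_one, one_mul]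

theorem le_newP (hσ : ∀ h, σ'.act (emb h) = σ.act h) (h : List (A × O)) (q : Q) :
    P.rp T σ h q ≤ (P.newP T).rp {Sum.inr true} σ' (emb h) (gmap P T q) := by
  revert h q
  refine rp_le _ _ _ (fun h q => (P.newP T).rp {Sum.inr true} σ' (emb h) (gmap P T q)) ?_ ?_
  · intro h q hq
    simp [gmap, hq, rp_top]
  · intro h q hq
    by_cases h2 : Pos P T q
    · have e : gmap P T q = Sum.inl q := by simp [gmap, hq, h2]
      rw [e, rp_not_mem _ _ _ (by simp)]
      have := fun a => P.newTr_sum_good T q ⟨hq, h2⟩ a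
        (fun o' s' => (P.newP T).rp {Sum.inr true} σ' (emb h ++ [(a, o')]) s')
      unfold stepOp
      have e2 : (P.newP T).tr = P.newTr T := rfl
      simp only [e2, this, hσ]
      refine Finset.sum_le_sum fun a _ => ?_
      gcongr with o _ q' _
      by_cases h1 : q' ∈ T
      · simp [gmap, fmap, h1, rp_top]
      · by_cases h3 : Pos P T q'
        · simp [fmap, h1, h3, emb_append]
        · have : ∀ h, (P.newP T).rp {Sum.inr true} σ' h (Sum.inr false) = 0 := fun h => by
            simpa using P.newP_le T σ σ' hσ h (Sum.inr false)
          simp [gmap, h1, h3, this]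
    · unfold stepOp
      refine le_of_eq_of_le ?_ zero_le
      refine Finset.sum_eq_zero fun a _ => ?_
      rw [Finset.sum_eq_zero, mul_zero]
      intro o _
      refine Finset.sum_eq_zero fun q' _ => ?_
      by_cases ht : P.tr q a o q' = 0
      · simp [ht]
      · have h3 : ¬ Pos P T q' := fun h3 => h2 (Pos.step ht h3)
        have h1 : q' ∉ T := fun h1 => h3 (Pos.base h1)
        have : ∀ h, (P.newP T).rp {Sum.inr true} σ' h (Sum.inr false) = 0 := fun h => by
          simpa using P.newP_le T σ σ' hσ h (Sum.inr false)
        simp [gmap, h1, h3, this]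

theorem rp_eq (hσ : ∀ h, σ'.act (emb h) = σ.act h) (q : Q) :
    P.rp T σ [] q = (P.newP T).rp {Sum.inr true} σ' [] (gmap P T q) := by
  refine le_antisymm (P.le_newP T σ σ' hσ [] q) ?_
  by_cases h1 : q ∈ T
  · simp [gmap, h1, rp_top, rp_mem]
  · have := P.newP_le T σ σ' hσ [] (gmap P T q)
    by_cases h2 : Pos P T q
    · simp only [gmap, h1, h2, if_true, if_false, not_false_eq_true, and_self] at this ⊢
      exact this.trans (iInf₂_le (f := fun h₀ (_ : [] = emb h₀) => P.rp T σ h₀ q) [] rfl)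
    · simp only [gmap, h1, h2, if_false] at this ⊢
      exact this.trans (by simp)

theorem reachProb_new (hσ : ∀ h, σ'.act (emb h) = σ.act h) (b : Q → ℝ≥0∞) :
    P.reachProb T b σ = (P.newP T).reachProb {Sum.inr true} (P.newB T b) σ' := by
  rw [reachProb_eq, reachProb_eq, newB_sum]
  refine Finset.sum_congr rfl fun q _ => ?_
  rw [P.rp_eq T σ σ' hσ]

/-- forget the new observations -/
def unemb (h : List (A × (O ⊕ Bool))) : List (A × O) :=
  h.filterMap fun x => match x.2 with
    | Sum.inl o => some (x.1, o)
    | Sum.inr _ => none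

theorem unemb_emb (h : List (A × O)) : unemb (emb h) = h := by
  induction h with
  | nil => rfl
  | cons x h ih =>
    simp only [emb, unemb, List.map_cons, List.filterMap_cons] at ih ⊢
    rw [ih]

theorem val_new (b : Q → ℝ≥0∞) :
    P.val T b = (P.newP T).val {Sum.inr true} (P.newB T b) := by
  refine le_antisymm (iSup_le fun σ => ?_) (iSup_le fun σ' => ?_)
  · let σ' : Strategy A (O ⊕ Bool) := ⟨fun h => σ.act (unemb h), fun h => σ.act_sum_one _⟩
    rw [P.reachProb_new T σ σ' (fun h => by simp [σ', unemb_emb])]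
    exact le_iSup (fun σ => (P.newP T).reachProb {Sum.inr true} (P.newB T b) σ) σ'
  · let σ : Strategy A O := ⟨fun h => σ'.act (emb h), fun h => σ'.act_sum_one _⟩
    rw [← P.reachProb_new T σ σ' (fun h => rfl)]
    exact le_iSup (fun σ => P.reachProb T b σ) σ

theorem rp_pos (hσ : ∀ h a, σ'.act h a ≠ 0) [Nonempty A] (q : Q) (hq : Pos P T q)
    (h : List (A × (O ⊕ Bool))) :
    (P.newP T).rp {Sum.inr true} σ' h (Sum.inl q) ≠ 0 := by
  induction hq generalizing h with
  | base h1 => rw [rp_bad _ _ _ _ _ (by simp [h1])]; simp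
  | @step q a o q' ht h3 ih =>
    by_cases h1 : q ∈ T
    · rw [rp_bad _ _ _ _ _ (by simp [h1])]; simp
    · have h2 : Pos P T q := Pos.step ht h3
      rw [rp_not_mem _ _ _ (by simp)]
      have := fun a => P.newTr_sum_good T q ⟨h1, h2⟩ a
        (fun o' s' => (P.newP T).rp {Sum.inr true} σ' (h ++ [(a, o')]) s')
      unfold stepOp
      have e2 : (P.newP T).tr = P.newTr T := rfl
      simp only [e2, this]
      intro h0
      simp only [Finset.sum_eq_zero_iff, Finset.mem_univ, true_imp_iff, mul_eq_zero, hσ,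
        false_or] at h0
      have h4 := (h0 a o q').resolve_left ht
      by_cases h5 : q' ∈ T
      · simp [gmap, h5, rp_top] at h4
      · simp only [gmap, h5, h3, if_true, if_false] at h4
        exact ih _ h4

theorem rp_bot (h : List (A × (O ⊕ Bool))) :
    (P.newP T).rp {Sum.inr true} σ' h (Sum.inr false) = 0 := by
  let σ : Strategy A O := ⟨fun h => σ'.act (emb h), fun h => σ'.act_sum_one _⟩
  simpa using P.newP_le T σ σ' (fun _ => rfl) h (Sum.inr false)

theorem val_zero_iff [Nonempty A] (s : Q ⊕ Bool) :
    (P.newP T).val {Sum.inr true} (dirac s) = 0 ↔ s = Sum.inr false := by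
  simp only [val, reachProb_dirac, ENNReal.iSup_eq_zero]
  constructor
  · intro h0
    let u : Strategy A (O ⊕ Bool) := ⟨fun _ _ => (Fintype.card A : ℝ≥0∞)⁻¹, fun h => by
      rw [Finset.sum_const, nsmul_eq_mul, Finset.card_univ, ENNReal.mul_inv_cancel] <;> simp⟩
    have h1 := h0 u
    rcases s with q | c
    · exfalso
      by_cases hq : Pos P T q
      · exact P.rp_pos T u (fun h a => by simp [u]) q hq [] h1
      · rw [rp_bad _ _ _ _ _ (by simp [hq])] at h1
        simp at h1
    · cases c
      · rfl
      · simp [rp_top] at h1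
  · rintro rfl σ'
    exact P.rp_bot T σ' []

end Aux

end POMDP

/-- Every POMDP with a target set `Tset` and initial belief `b`
can be transformed into a POMDP with two new states `⊤ = Sum.inr true` and
`⊥ = Sum.inr false`, both absorbing and observable, such that `⊥` is the only
state of value `0` and the reachability value is preserved. -/
theorem stmt0 {Q A O : Type} [Fintype Q] [Fintype A] [Fintype O]
    [Nonempty Q] [Nonempty A] [Nonempty O]
    (P : POMDP Q A O) (Tset : Set Q) (b : Q → ℝ≥0∞) (hb : (∑ q : Q, b q) = 1) :
    ∃ (P' : POMDP (Q ⊕ Bool) A (O ⊕ Bool)) (b' : Q ⊕ Bool → ℝ≥0∞),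
      (∑ q : Q ⊕ Bool, b' q) = 1 ∧
      P'.Absorbing (Sum.inr true) ∧ P'.Observable (Sum.inr true) ∧
      P'.Absorbing (Sum.inr false) ∧ P'.Observable (Sum.inr false) ∧
      (∀ q : Q ⊕ Bool, P'.val {Sum.inr true} (dirac q) = 0 ↔ q = Sum.inr false) ∧
      P.val Tset b = P'.val {Sum.inr true} b' := by
  refine ⟨P.newP Tset, P.newB Tset b, ?_, P.newP_absorbing Tset _, P.newP_observable Tset _,
    P.newP_absorbing Tset _, P.newP_observable Tset _, P.val_zero_iff Tset, P.val_new Tset b⟩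
  simpa [hb] using P.newB_sum Tset b (fun _ => 1)
end

section
/- Let P be a posterior-deterministic POMDP. Then the nonempty belief supports of P split into disjoint maximal SECs and singletons: every SEC of P is contained in a maximal SEC, and the domains of any two distinct maximal SECs are disjoint (equivalently, every nonempty belief support belongs to the domain of at most one maximal SEC). -/
open scoped ENNReal BigOperators Classical
open Filter Topology

namespace POMDP

theorem insideFrom_mono {Q A O : Type} [Fintype Q] [Fintype A] [Fintype O] (P : POMDP Q A O)
    {dom dom' : Set (Finset Q)} {act act' : Finset Q → Finset A}
    (hd : dom ⊆ dom') (ha : ∀ S ∈ dom, act S ⊆ act' S) :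
    ∀ (h : List (A × O)) (S : Finset Q), InsideFrom P dom act S h → InsideFrom P dom' act' S h
  | [], _, _ => trivial
  | (_, _) :: h, S, hi =>
    ⟨hd hi.1, ha S hi.1 hi.2.1, insideFrom_mono P hd ha h _ hi.2.2⟩

theorem insideFrom_append {Q A O : Type} [Fintype Q] [Fintype A] [Fintype O] (P : POMDP Q A O)
    {dom : Set (Finset Q)} {act : Finset Q → Finset A} (h' : List (A × O)) :
    ∀ (h : List (A × O)) (S : Finset Q), InsideFrom P dom act S h →
      InsideFrom P dom act (P.stepSetStar S h) h' → InsideFrom P dom act S (h ++ h')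
  | [], _, _, h2 => h2
  | (_, _) :: h, _, hi, h2 =>
    ⟨hi.1, hi.2.1, insideFrom_append P h' h _ hi.2.2 h2⟩

theorem stepSetStar_append {Q A O : Type} [Fintype Q] [Fintype A] [Fintype O] (P : POMDP Q A O)
    (h' : List (A × O)) :
    ∀ (h : List (A × O)) (S : Finset Q),
      P.stepSetStar S (h ++ h') = P.stepSetStar (P.stepSetStar S h) h'
  | [], _ => rfl
  | (_, _) :: h, _ => stepSetStar_append P h' h _

/-- Two SECs sharing a support are both contained in a common SEC. -/
theorem exists_union {Q A O : Type} [Fintype Q] [Fintype A] [Fintype O] {P : POMDP Q A O}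
    (f g : SEC P) (S : Finset Q) (hf : S ∈ f.dom) (hg : S ∈ g.dom) :
    ∃ u : SEC P, f.Contained u ∧ g.Contained u := by
  let D : Set (Finset Q) := f.dom ∪ g.dom
  let B : Finset Q → Finset A := fun T =>
    (if T ∈ f.dom then f.act T else ∅) ∪ (if T ∈ g.dom then g.act T else ∅)
  have fD : f.dom ⊆ D := Set.subset_union_left
  have gD : g.dom ⊆ D := Set.subset_union_right
  have fB : ∀ T ∈ f.dom, f.act T ⊆ B T := by
    intro T hT a ha
    simp [B, hT, ha]
  have gB : ∀ T ∈ g.dom, g.act T ⊆ B T := by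
    intro T hT a ha
    simp [B, hT, ha]
  have toS : ∀ T ∈ D, ∃ h, InsideFrom P D B T h ∧ P.stepSetStar T h = S := by
    rintro T (hT | hT)
    · obtain ⟨h, h1, h2⟩ := f.connected T hT S hf
      exact ⟨h, insideFrom_mono P fD fB h T h1, h2⟩
    · obtain ⟨h, h1, h2⟩ := g.connected T hT S hg
      exact ⟨h, insideFrom_mono P gD gB h T h1, h2⟩
  have fromS : ∀ T ∈ D, ∃ h, InsideFrom P D B S h ∧ P.stepSetStar S h = T := by
    rintro T (hT | hT)
    · obtain ⟨h, h1, h2⟩ := f.connected S hf T hT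
      exact ⟨h, insideFrom_mono P fD fB h S h1, h2⟩
    · obtain ⟨h, h1, h2⟩ := g.connected S hg T hT
      exact ⟨h, insideFrom_mono P gD gB h S h1, h2⟩
  refine ⟨⟨D, B, ?_, ?_, ?_, ?_⟩, ⟨fD, fB⟩, ⟨gD, gB⟩⟩
  · rintro T (hT | hT)
    · exact f.dom_nonempty T hT
    · exact g.dom_nonempty T hT
  · rintro T (hT | hT)
    · exact (f.act_nonempty T hT).mono (fB T hT)
    · exact (g.act_nonempty T hT).mono (gB T hT)
  · intro T _ a ha o hne
    rcases Finset.mem_union.1 ha with ha | ha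
    · split_ifs at ha with hT
      · exact fD (f.closed T hT a ha o hne)
      · simp at ha
    · split_ifs at ha with hT
      · exact gD (g.closed T hT a ha o hne)
      · simp at ha
  · intro T hT T' hT'
    obtain ⟨h, h1, h2⟩ := toS T hT
    obtain ⟨h', h1', h2'⟩ := fromS T' hT'
    refine ⟨h ++ h', insideFrom_append P h' h T h1 (h2 ▸ h1'), ?_⟩
    rw [stepSetStar_append, h2, h2']

/-- The graph of an SEC. -/
def SEC.graph {Q A O : Type} [Fintype Q] [Fintype A] [Fintype O] {P : POMDP Q A O}
    (f : SEC P) : Set (Finset Q × A) := {p | p.1 ∈ f.dom ∧ p.2 ∈ f.act p.1}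

theorem contained_iff {Q A O : Type} [Fintype Q] [Fintype A] [Fintype O] {P : POMDP Q A O}
    (f g : SEC P) : f.Contained g ↔ f.graph ⊆ g.graph := by
  constructor
  · rintro ⟨h1, h2⟩ ⟨S, a⟩ ⟨hS, ha⟩
    exact ⟨h1 hS, h2 S hS ha⟩
  · intro h
    refine ⟨fun S hS => ?_, fun S hS a ha => (h (show (S, a) ∈ f.graph from ⟨hS, ha⟩)).2⟩
    obtain ⟨a, ha⟩ := f.act_nonempty S hS
    exact (h (show (S, a) ∈ f.graph from ⟨hS, ha⟩)).1

end POMDP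

/-- In a posterior-deterministic POMDP, the belief supports split
into disjoint maximal SECs and singletons: every SEC is contained in a maximal SEC,
and two maximal SECs whose domains intersect coincide. -/
theorem stmt2 {Q A O : Type} [Fintype Q] [Fintype A] [Fintype O]
    (P : POMDP Q A O) (hP : P.PostDet) :
    (∀ f : POMDP.SEC P, ∃ g : POMDP.SEC P, f.Contained g ∧ g.Maximal) ∧
    (∀ f g : POMDP.SEC P, f.Maximal → g.Maximal →
      ∀ S : Finset Q, S ∈ f.dom → S ∈ g.dom →
        f.dom = g.dom ∧ ∀ T ∈ f.dom, f.act T = g.act T) := by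
  constructor
  · intro f
    obtain ⟨m, hfm, hm⟩ := (Set.toFinite (Set.range (POMDP.SEC.graph (P := P)))).exists_le_maximal
      (Set.mem_range_self f)
    obtain ⟨g, rfl⟩ := hm.prop
    refine ⟨g, (POMDP.contained_iff f g).2 hfm, fun g' hg' => ?_⟩
    have h2 : g'.Contained g := (POMDP.contained_iff g' g).2
      (hm.le_of_ge (Set.mem_range_self g') ((POMDP.contained_iff g g').1 hg'))
    exact ⟨h2.1.antisymm hg'.1, fun S hS => (h2.2 S (hg'.1 hS)).antisymm (hg'.2 S hS)⟩
  · intro f g hf hg S hSf hSg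
    obtain ⟨u, hfu, hgu⟩ := POMDP.exists_union f g S hSf hSg
    obtain ⟨h1, h2⟩ := hf u hfu
    obtain ⟨h3, h4⟩ := hg u hgu
    have h5 : f.dom = g.dom := h1.symm.trans h3
    exact ⟨h5, fun T hT => (h2 T hT).symm.trans (h4 T (h5 ▸ hT))⟩
end

section
/- Let P be a posterior-deterministic POMDP, f a non-distinguishing SEC of P, and b a belief with supp(b) ∈ dom f. Then the set Reach_f(b) of beliefs reachable from b inside f is finite. -/
open scoped ENNReal BigOperators Classical
open Filter Topology

/-- Pushforward of a belief along a map of states. -/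
noncomputable def pushBel {Q : Type} [Fintype Q] (b : Q → ℝ≥0∞) (g : Q → Q) : Q → ℝ≥0∞ :=
  fun q => ∑ q' : Q, if g q' = q then b q' else 0

theorem pushBel_sum {Q : Type} [Fintype Q] (b : Q → ℝ≥0∞) (g : Q → Q) :
    ∑ q, pushBel b g q = ∑ q, b q := by
  unfold pushBel
  rw [Finset.sum_comm]
  simp

theorem pushBel_push {Q : Type} [Fintype Q] (b : Q → ℝ≥0∞) (g g' : Q → Q) :
    pushBel (pushBel b g) g' = pushBel b (g' ∘ g) := by
  funext q
  unfold pushBel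
  have h : ∀ x : Q, (if g' x = q then ∑ y : Q, (if g y = x then b y else 0) else 0)
      = ∑ y : Q, if g y = x then (if g' (g y) = q then b y else 0) else 0 := by
    intro x
    split_ifs with hx
    · refine Finset.sum_congr rfl fun y _ => ?_
      by_cases hy : g y = x
      · subst hy; simp [hx]
      · simp [hy]
    · symm
      refine Finset.sum_eq_zero fun y _ => ?_
      by_cases hy : g y = x
      · subst hy; simp [hx]
      · simp [hy]
  rw [Finset.sum_congr rfl fun x _ => h x, Finset.sum_comm]
  simp

theorem step_cases {Q A O : Type} [Fintype Q] [Fintype A] [Fintype O]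
    (P : POMDP Q A O) (hP : P.PostDet)
    (f : POMDP.SEC P) (hnd : f.NonDistinguishing)
    (b : Q → ℝ≥0∞) (hb : (∑ q : Q, b q) = 1) (hS : beliefSupp b ∈ f.dom)
    (a : A) (ha : a ∈ f.act (beliefSupp b)) (o : O) :
    (P.stepSet (beliefSupp b) a o = ∅ ∧ P.belStep b a o = 0) ∨
    (P.stepSet (beliefSupp b) a o ∈ f.dom ∧
      beliefSupp (P.belStep b a o) = P.stepSet (beliefSupp b) a o ∧
      ∃ g : Q → Q, P.belStep b a o = pushBel b g) := by
  have mem : ∀ q, q ∈ P.stepSet (beliefSupp b) a o ↔ ∃ q', b q' ≠ 0 ∧ P.tr q' a o q ≠ 0 := by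
    intro q
    simp [POMDP.stepSet, POMDP.succs, beliefSupp]
  rcases Finset.eq_empty_or_nonempty (P.stepSet (beliefSupp b) a o) with he | hne
  · left
    refine ⟨he, ?_⟩
    funext q
    have : ∑ q' : Q, b q' * P.tr q' a o q = 0 := by
      refine Finset.sum_eq_zero fun q' _ => ?_
      by_contra hc
      have : q ∈ P.stepSet (beliefSupp b) a o :=
        (mem q).2 ⟨q', left_ne_zero_of_mul hc, right_ne_zero_of_mul hc⟩
      simp [he] at this
    simp [POMDP.belStep, this]
  · right
    have hdom := f.closed _ hS a ha o hne
    obtain ⟨x, hx⟩ := hne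
    obtain ⟨p, hbp, hpx⟩ := (mem x).1 hx
    set c := P.trO p a o with hc
    have hc0 : c ≠ 0 := by
      intro h0
      rw [hc, POMDP.trO, Finset.sum_eq_zero_iff] at h0
      exact hpx (h0 x (Finset.mem_univ _))
    have hct : c ≠ ⊤ := by
      have : c ≤ 1 := by
        rw [← P.tr_sum_one p a]
        exact Finset.single_le_sum (f := fun o => ∑ q', P.tr p a o q')
          (fun _ _ => zero_le) (Finset.mem_univ o)
      exact ne_top_of_le_ne_top ENNReal.one_ne_top this
    have hcomm : ∀ q, b q ≠ 0 → P.trO q a o = c := by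
      intro q hq
      exact hnd _ hS q (by simp [beliefSupp, hq]) p (by simp [beliefSupp, hbp]) [] trivial a ha o
        q (by simp [POMDP.stepSetStar]) p (by simp [POMDP.stepSetStar])
    have hex : ∀ q, ∃ y, b q ≠ 0 → P.tr q a o y ≠ 0 := by
      intro q
      by_cases hq : b q = 0
      · exact ⟨q, fun h => absurd hq h⟩
      · by_contra hcon
        push Not at hcon
        refine hc0 ?_
        rw [← hcomm q hq, POMDP.trO]
        exact Finset.sum_eq_zero fun y _ => (hcon y).2
    choose g hg using hex
    have htr : ∀ q, b q ≠ 0 → ∀ y, P.tr q a o y = if g q = y then c else 0 := by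
      intro q hq y
      have hz : ∀ z, z ≠ g q → P.tr q a o z = 0 := by
        intro z hz
        by_contra h
        exact hz (hP q a o z (g q) h (hg q hq))
      split_ifs with h
      · rw [← hcomm q hq, POMDP.trO, Finset.sum_eq_single y]
        · intro z _ hzy
          exact hz z (by rw [h]; exact hzy)
        · simp
      · exact hz y fun h' => h h'.symm
    have hden : P.trOBel b a o = c := by
      have : ∀ q, b q * P.trO q a o = b q * c := by
        intro q
        by_cases hq : b q = 0
        · simp [hq]
        · rw [hcomm q hq]
      rw [POMDP.trOBel, Finset.sum_congr rfl fun q _ => this q, ← Finset.sum_mul, hb, one_mul]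
    have hpush : P.belStep b a o = pushBel b g := by
      funext q
      have : ∀ q', b q' * P.tr q' a o q = (if g q' = q then b q' else 0) * c := by
        intro q'
        by_cases hq : b q' = 0
        · simp [hq]
        · rw [htr q' hq]
          split_ifs <;> simp
      rw [POMDP.belStep, hden, Finset.sum_congr rfl fun q' _ => this q', ← Finset.sum_mul,
        ENNReal.mul_div_cancel_right hc0 hct]
      rfl
    refine ⟨hdom, ?_, g, hpush⟩
    ext q
    rw [mem, hpush]
    simp only [beliefSupp, pushBel, Finset.mem_filter, Finset.mem_univ, true_and, ne_eq,
      Finset.sum_eq_zero_iff, not_forall, true_imp_iff]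
    refine exists_congr fun q' => ?_
    by_cases hq : b q' = 0
    · simp [hq]
    · rw [htr q' hq]
      by_cases h : g q' = q <;> simp [h, hq, hc0]

theorem star_cases {Q A O : Type} [Fintype Q] [Fintype A] [Fintype O]
    (P : POMDP Q A O) (hP : P.PostDet)
    (f : POMDP.SEC P) (hnd : f.NonDistinguishing) (h : List (A × O)) :
    ∀ (b : Q → ℝ≥0∞), (∑ q : Q, b q) = 1 → beliefSupp b ∈ f.dom →
      POMDP.InsideFrom P f.dom f.act (beliefSupp b) h →
      P.belStepStar b h = 0 ∨ ∃ g : Q → Q, P.belStepStar b h = pushBel b g := by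
  induction h with
  | nil =>
    intro b _ _ _
    right
    refine ⟨id, ?_⟩
    funext q
    simp [POMDP.belStepStar, pushBel]
  | cons ao h ih =>
    obtain ⟨a, o⟩ := ao
    intro b hb hS hin
    obtain ⟨_, ha, hin⟩ := hin
    rcases step_cases P hP f hnd b hb hS a ha o with ⟨he, h0⟩ | ⟨hd, hs, g, hg⟩
    · left
      rw [he] at hin
      cases h with
      | nil => exact h0
      | cons ao' t =>
        obtain ⟨a', o'⟩ := ao'
        have := f.dom_nonempty _ hin.1
        simp at this
    · rw [← hs] at hd hin
      rcases ih _ (by rw [hg, pushBel_sum, hb]) hd hin with h0 | ⟨g', hg'⟩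
      · exact Or.inl h0
      · refine Or.inr ⟨g' ∘ g, ?_⟩
        rw [← pushBel_push, ← hg]
        exact hg'

/-- For a non-distinguishing SEC `f` of a posterior-deterministic
POMDP and a belief `b` with `supp(b) ∈ dom f`, the set `Reach_f(b)` of beliefs
reachable from `b` inside `f` is finite. -/
theorem stmt5 {Q A O : Type} [Fintype Q] [Fintype A] [Fintype O]
    (P : POMDP Q A O) (hP : P.PostDet)
    (f : POMDP.SEC P) (hnd : f.NonDistinguishing)
    (b : Q → ℝ≥0∞) (hb : (∑ q : Q, b q) = 1) (hS : beliefSupp b ∈ f.dom) :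
    (POMDP.reachBel P f b).Finite := by
  refine ((Set.finite_range (pushBel b)).insert 0).subset ?_
  rintro b' ⟨h, hin, rfl⟩
  rcases star_cases P hP f hnd h b hb hS hin with h0 | ⟨g, hg⟩
  · exact Or.inl h0
  · exact Or.inr ⟨g, hg.symm⟩
end

section
/- Let P be a posterior-deterministic POMDP, f an SEC of P, S ∈ dom f, q, q' ∈ S, a ∈ f(S), and o ∈ O such that δ(q,a,o), δ(q',a,o) are defined. Write q_{ao} = δ(q,a,o), q'_{ao} = δ(q',a,o), S_{ao} = δ(S,a,o). Then: (1) if q and q' are (f,S)-indistinguishable, then q_{ao} and q'_{ao} are (f,S_{ao})-indistinguishable; (2) if q and q' are (f,S)-distinguishable, then q_{ao} and q'_{ao} are (f,S_{ao})-distinguishable. -/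
open scoped ENNReal BigOperators Classical
open Filter Topology

namespace POMDP

variable {Q A O : Type} [Fintype Q] [Fintype A] [Fintype O]

theorem aux_star_append (P : POMDP Q A O) (h₁ h₂ : List (A × O)) (S : Finset Q) :
    P.stepSetStar S (h₁ ++ h₂) = P.stepSetStar (P.stepSetStar S h₁) h₂ := by
  induction h₁ generalizing S with
  | nil => rfl
  | cons x t ih => exact ih _

theorem aux_inside_append (P : POMDP Q A O) (dom : Set (Finset Q)) (act : Finset Q → Finset A)
    (h₁ h₂ : List (A × O)) (S : Finset Q) (H₁ : InsideFrom P dom act S h₁)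
    (H₂ : InsideFrom P dom act (P.stepSetStar S h₁) h₂) :
    InsideFrom P dom act S (h₁ ++ h₂) := by
  induction h₁ generalizing S with
  | nil => exact H₂
  | cons x t ih => exact ⟨H₁.1, H₁.2.1, ih _ H₁.2.2 H₂⟩

theorem aux_mem_star (P : POMDP Q A O) (h : List (A × O)) (S : Finset Q) (y : Q) :
    y ∈ P.stepSetStar S h ↔ ∃ x ∈ S, y ∈ P.stepSetStar {x} h := by
  induction h generalizing S with
  | nil => simp [stepSetStar]
  | cons p t ih =>
    obtain ⟨a, o⟩ := p
    simp only [stepSetStar]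
    rw [ih]
    constructor
    · rintro ⟨z, hz, hy⟩
      simp only [stepSet, Finset.mem_biUnion] at hz
      obtain ⟨x, hx, hz⟩ := hz
      refine ⟨x, hx, ?_⟩
      rw [ih]
      exact ⟨z, by simpa [stepSet] using hz, hy⟩
    · rintro ⟨x, hx, hy⟩
      rw [ih] at hy
      obtain ⟨z, hz, hy⟩ := hy
      refine ⟨z, ?_, hy⟩
      simp only [stepSet, Finset.mem_biUnion, Finset.mem_singleton] at hz ⊢
      obtain ⟨x', rfl, hz⟩ := hz
      exact ⟨x', hx, hz⟩

theorem aux_stepSet_singleton (P : POMDP Q A O) (hP : P.PostDet) (q : Q) (a : A) (o : O) (x : Q)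
    (hx : x ∈ P.succs q a o) : P.stepSet {q} a o = {x} := by
  ext y
  simp only [stepSet, Finset.singleton_biUnion, Finset.mem_singleton]
  constructor
  · intro hy
    simp only [succs, Finset.mem_filter] at hx hy
    exact hP q a o _ _ hy.2 hx.2
  · rintro rfl
    exact hx

theorem aux_star_unique (P : POMDP Q A O) (hP : P.PostDet) (h : List (A × O)) (x y z : Q)
    (hy : y ∈ P.stepSetStar {x} h) (hz : z ∈ P.stepSetStar {x} h) : y = z := by
  induction h generalizing x with
  | nil =>
    simp only [stepSetStar, Finset.mem_singleton] at hy hz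
    rw [hy, hz]
  | cons p t ih =>
    obtain ⟨a, o⟩ := p
    simp only [stepSetStar] at hy hz
    obtain ⟨w, hw, hyw⟩ := (P.aux_mem_star t _ y).1 hy
    have hw' : w ∈ P.succs x a o := by simpa [stepSet] using hw
    rw [P.aux_stepSet_singleton hP x a o w hw'] at hy hz
    exact ih w hy hz

/-- A loop on a support acts as a permutation of that support. -/
theorem aux_perm (P : POMDP Q A O) (hP : P.PostDet) (h : List (A × O)) (S : Finset Q)
    (hS : P.stepSetStar S h = S) :
    ∃ σ : Equiv.Perm S, ∀ x : S, P.stepSetStar {x.1} h = {(σ x).1} := by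
  have hpre : ∀ y : S, ∃ x : S, y.1 ∈ P.stepSetStar {x.1} h := by
    intro y
    have hy : y.1 ∈ P.stepSetStar S h := by rw [hS]; exact y.2
    obtain ⟨x, hx, hxy⟩ := (P.aux_mem_star h S y.1).1 hy
    exact ⟨⟨x, hx⟩, hxy⟩
  choose g hg using hpre
  have hinj : Function.Injective g := by
    intro y z hyz
    have h1 := hg y
    rw [hyz] at h1
    exact Subtype.ext (P.aux_star_unique hP h _ _ _ h1 (hg z))
  have hbij : Function.Bijective g := Finite.injective_iff_bijective.1 hinj
  refine ⟨(Equiv.ofBijective g hbij).symm, fun x => ?_⟩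
  have hx := hg ((Equiv.ofBijective g hbij).symm x)
  have hgx : g ((Equiv.ofBijective g hbij).symm x) = x :=
    (Equiv.ofBijective g hbij).apply_symm_apply x
  rw [hgx] at hx
  ext y
  rw [Finset.mem_singleton]
  constructor
  · intro hy
    exact P.aux_star_unique hP h _ _ _ hy hx
  · rintro rfl
    exact hx

/-- Iterating a loop. -/
theorem aux_iter (P : POMDP Q A O) (dom : Set (Finset Q)) (act : Finset Q → Finset A)
    (h : List (A × O)) (S : Finset Q) (hS : P.stepSetStar S h = S)
    (hI : InsideFrom P dom act S h)
    (σ : Equiv.Perm S) (hσ : ∀ x : S, P.stepSetStar {x.1} h = {(σ x).1}) (n : ℕ) :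
    ∃ L : List (A × O), InsideFrom P dom act S L ∧ P.stepSetStar S L = S ∧
      ∀ x : S, P.stepSetStar {x.1} L = {((σ ^ n) x).1} := by
  induction n with
  | zero => exact ⟨[], trivial, rfl, fun x => rfl⟩
  | succ n ih =>
    obtain ⟨L, h1, h2, h3⟩ := ih
    refine ⟨h ++ L, P.aux_inside_append dom act h L S hI (by rw [hS]; exact h1), ?_, ?_⟩
    · rw [aux_star_append, hS, h2]
    · intro x
      rw [aux_star_append, hσ, h3, pow_succ, Equiv.Perm.mul_apply]

end POMDP

/-- In a posterior-deterministic POMDP, inside an SEC, both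
`(f,S)`-indistinguishability and `(f,S)`-distinguishability are preserved by
taking a prescribed transition `(a, o)`. -/
theorem stmt6 {Q A O : Type} [Fintype Q] [Fintype A] [Fintype O]
    (P : POMDP Q A O) (hP : P.PostDet)
    (f : POMDP.SEC P) (S : Finset Q) (hS : S ∈ f.dom)
    (q q' : Q) (hq : q ∈ S) (hq' : q' ∈ S)
    (a : A) (ha : a ∈ f.act S) (o : O)
    (qao q'ao : Q) (hqao : qao ∈ P.succs q a o) (hq'ao : q'ao ∈ P.succs q' a o) :
    (POMDP.Indist P f S q q' →
      POMDP.Indist P f (P.stepSet S a o) qao q'ao) ∧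
    (¬ POMDP.Indist P f S q q' →
      ¬ POMDP.Indist P f (P.stepSet S a o) qao q'ao) := by
  have e1 := P.aux_stepSet_singleton hP q a o qao hqao
  have e2 := P.aux_stepSet_singleton hP q' a o q'ao hq'ao
  constructor
  · intro H h hh b hb o' x hx y hy
    refine H ((a, o) :: h) ⟨hS, ha, hh⟩ b hb o' x ?_ y ?_
    · simpa only [POMDP.stepSetStar, e1] using hx
    · simpa only [POMDP.stepSetStar, e2] using hy
  · intro hn H
    apply hn
    have hdom : P.stepSet S a o ∈ f.dom :=
      f.closed S hS a ha o ⟨qao, by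
        simp only [POMDP.stepSet, Finset.mem_biUnion]
        exact ⟨q, hq, hqao⟩⟩
    obtain ⟨w, hw, hwS⟩ := f.connected _ hdom S hS
    have hloop : P.stepSetStar S ((a, o) :: w) = S := hwS
    have hin : POMDP.InsideFrom P f.dom f.act S ((a, o) :: w) := ⟨hS, ha, hw⟩
    obtain ⟨σ, hσ⟩ := P.aux_perm hP _ S hloop
    obtain ⟨L, hL1, hL2, hL3⟩ :=
      P.aux_iter f.dom f.act _ S hloop hin σ hσ (orderOf σ - 1)
    have key : ∀ x : S, P.stepSetStar {x.1} (((a, o) :: w) ++ L) = {x.1} := by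
      intro x
      rw [POMDP.aux_star_append, hσ, hL3, ← Equiv.Perm.mul_apply, ← pow_succ,
        Nat.sub_add_cancel (orderOf_pos σ), pow_orderOf_eq_one]
      rfl
    have k1 : P.stepSetStar {qao} (w ++ L) = {q} := by
      rw [← e1]
      exact key ⟨q, hq⟩
    have k2 : P.stepSetStar {q'ao} (w ++ L) = {q'} := by
      rw [← e2]
      exact key ⟨q', hq'⟩
    have kS : P.stepSetStar (P.stepSet S a o) (w ++ L) = S := by
      rw [POMDP.aux_star_append, hwS, hL2]
    have kI : POMDP.InsideFrom P f.dom f.act (P.stepSet S a o) (w ++ L) :=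
      P.aux_inside_append _ _ _ _ _ hw (by rw [hwS]; exact hL1)
    intro h hh b hb o' x hx y hy
    refine H ((w ++ L) ++ h) (P.aux_inside_append _ _ _ _ _ kI (by rw [kS]; exact hh)) b ?_ o'
      x ?_ y ?_
    · rw [POMDP.aux_star_append, kS]; exact hb
    · rw [POMDP.aux_star_append, k1]; exact hx
    · rw [POMDP.aux_star_append, k2]; exact hy
end

section
/- Let P be a posterior-deterministic POMDP and f an SEC of P. For every belief b with supp(b) ∈ dom f, every action a ∈ f(supp(b)), every observation o ∈ O with T(o | b, a) > 0, and every state q ∈ supp(b) with T(o|q,a) > 0, the updated belief satisfies δ(b,a,o)(δ(q,a,o)) = T(o | q, a) · b(q) / T(o | b, a). -/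
open scoped ENNReal BigOperators Classical
open Filter Topology

theorem stepSet_card_le {Q A O : Type} [Fintype Q] [Fintype A] [Fintype O]
    (P : POMDP Q A O) (hP : P.PostDet) (S : Finset Q) (a : A) (o : O) :
    (P.stepSet S a o).card ≤ S.card := by
  unfold POMDP.stepSet
  refine (Finset.card_biUnion_le_card_mul S _ 1 ?_).trans (by simp)
  intro q _
  rw [Finset.card_le_one]
  intro x hx y hy
  simp only [POMDP.succs, Finset.mem_filter, Finset.mem_univ, true_and] at hx hy
  exact hP q a o x y hx hy

theorem stepSetStar_card_le {Q A O : Type} [Fintype Q] [Fintype A] [Fintype O]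
    (P : POMDP Q A O) (hP : P.PostDet) (h : List (A × O)) :
    ∀ S : Finset Q, (P.stepSetStar S h).card ≤ S.card := by
  induction h with
  | nil => intro S; simp [POMDP.stepSetStar]
  | cons x h ih =>
    intro S
    obtain ⟨a, o⟩ := x
    simp only [POMDP.stepSetStar]
    exact (ih _).trans (stepSet_card_le P hP S a o)

/-- Belief update formula inside an SEC of a
posterior-deterministic POMDP:
`δ(b,a,o)(δ(q,a,o)) = T(o | q, a) · b(q) / T(o | b, a)`. -/
theorem stmt9 {Q A O : Type} [Fintype Q] [Fintype A] [Fintype O]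
    (P : POMDP Q A O) (hP : P.PostDet)
    (f : POMDP.SEC P)
    (b : Q → ℝ≥0∞) (hb : (∑ q : Q, b q) = 1) (hS : beliefSupp b ∈ f.dom)
    (a : A) (ha : a ∈ f.act (beliefSupp b))
    (o : O) (ho : P.trOBel b a o ≠ 0)
    (q : Q) (hq : q ∈ beliefSupp b) (hqo : P.trO q a o ≠ 0)
    (qao : Q) (hqao : qao ∈ P.succs q a o) :
    P.belStep b a o qao = P.trO q a o * b q / P.trOBel b a o := by
  have hinj : ∀ q' : Q, q' ≠ q → b q' * P.tr q' a o qao = 0 := by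
    intro q' hne
    by_contra hcon
    have hb' : b q' ≠ 0 := fun h => hcon (by simp [h])
    have ht' : P.tr q' a o qao ≠ 0 := fun h => hcon (by simp [h])
    have hq'S : q' ∈ beliefSupp b := by simp [beliefSupp, hb']
    have hsub : P.stepSet (beliefSupp b) a o ⊆ P.stepSet ((beliefSupp b).erase q') a o := by
      intro x hx
      simp only [POMDP.stepSet, Finset.mem_biUnion] at hx ⊢
      obtain ⟨p, hp, hpx⟩ := hx
      by_cases hpq : p = q'
      · subst hpq
        have hx' : P.tr p a o x ≠ 0 := by simpa [POMDP.succs] using hpx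
        have : x = qao := hP p a o x qao hx' ht'
        subst this
        exact ⟨q, Finset.mem_erase.mpr ⟨hne.symm, hq⟩, hqao⟩
      · exact ⟨p, Finset.mem_erase.mpr ⟨hpq, hp⟩, hpx⟩
    have hlt : (P.stepSet (beliefSupp b) a o).card < (beliefSupp b).card :=
      ((Finset.card_le_card hsub).trans (stepSet_card_le P hP _ a o)).trans_lt
        (Finset.card_erase_lt_of_mem hq'S)
    have hne' : (P.stepSet (beliefSupp b) a o).Nonempty :=
      ⟨qao, Finset.mem_biUnion.mpr ⟨q, hq, hqao⟩⟩
    obtain ⟨h, -, hh⟩ := f.connected _ (f.closed _ hS a ha o hne') _ hS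
    have := stepSetStar_card_le P hP h (P.stepSet (beliefSupp b) a o)
    rw [hh] at this
    omega
  have ht : P.tr q a o qao ≠ 0 := by simpa [POMDP.succs] using hqao
  have h1 : P.trO q a o = P.tr q a o qao := by
    unfold POMDP.trO
    refine Finset.sum_eq_single qao ?_ (by simp)
    intro x _ hx
    by_contra hcon
    exact hx (hP q a o x qao hcon ht)
  have h2 : (∑ q' : Q, b q' * P.tr q' a o qao) = b q * P.tr q a o qao :=
    Finset.sum_eq_single q (fun x _ hx => hinj x hx) (by simp)
  unfold POMDP.belStep
  rw [h2, h1, mul_comm]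
end
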